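/- For every (a,b,c) ∈ ℝ³, ‖(|a|,|b|,|c|)‖ ≤ (5+4√2)·‖(a,b,c)‖. Moreover this inequality is sharp: for the triple (1, 5+4√2, −4−4√2) one has ‖(1, 5+4√2, −4−4√2)‖ = 1 and ‖(1, 5+4√2, 4+4√2)‖ = 5+4√2. Hence the unconditional constant of the canonical basis {x², y², xy} of the space of 2-homogeneous polynomials on ℝ² with the supremum norm over D(π/4) is 5+4√2. -/

import Mathlib

open Real Set

noncomputable section

/-- The sector D(π/4): points (x,y) with 0 ≤ y ≤ x and x² + y² ≤ 1. -/
def sector : Set (ℝ × ℝ) := {p | 0 ≤ p.2 ∧ p.2 ≤ p.1 ∧ p.1 ^ 2 + p.2 ^ 2 ≤ 1}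

/-- The supremum norm of the 2-homogeneous polynomial a·x² + b·y² + c·x·y over the sector. -/
def secNorm (a b c : ℝ) : ℝ :=
  sSup ((fun p : ℝ × ℝ => |a * p.1 ^ 2 + b * p.2 ^ 2 + c * p.1 * p.2|) '' sector)

theorem abs_le_secNorm (a b c : ℝ) {p : ℝ × ℝ} (hp : p ∈ sector) :
    |a * p.1 ^ 2 + b * p.2 ^ 2 + c * p.1 * p.2| ≤ secNorm a b c := by
  refine le_csSup ⟨|a| + |b| + |c|, ?_⟩ ⟨p, hp, rfl⟩
  rintro _ ⟨⟨x, y⟩, ⟨h0, h1, h2⟩, rfl⟩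
  dsimp only at h0 h1 h2 ⊢
  have hx : x ^ 2 ≤ 1 := by nlinarith
  have hy : y ^ 2 ≤ 1 := by nlinarith
  have hxy : x * y ≤ 1 := by nlinarith
  have hxy' : 0 ≤ x * y := mul_nonneg (h0.trans h1) h0
  calc |a * x ^ 2 + b * y ^ 2 + c * x * y|
      ≤ |a * x ^ 2| + |b * y ^ 2| + |c * x * y| := abs_add_three _ _ _
    _ = |a| * x ^ 2 + |b| * y ^ 2 + |c| * (x * y) := by
        rw [mul_assoc c, abs_mul, abs_mul, abs_mul, abs_of_nonneg hxy',
          abs_of_nonneg (sq_nonneg x), abs_of_nonneg (sq_nonneg y)]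
    _ ≤ |a| + |b| + |c| := by
        nlinarith [mul_le_mul_of_nonneg_left hx (abs_nonneg a),
          mul_le_mul_of_nonneg_left hy (abs_nonneg b),
          mul_le_mul_of_nonneg_left hxy (abs_nonneg c)]

theorem secNorm_le {a b c M : ℝ}
    (h : ∀ x y : ℝ, 0 ≤ y → y ≤ x → x ^ 2 + y ^ 2 ≤ 1 →
      |a * x ^ 2 + b * y ^ 2 + c * x * y| ≤ M) : secNorm a b c ≤ M := by
  refine csSup_le ⟨_, (0, 0), ?_, rfl⟩ ?_
  · simp [sector]
  · rintro _ ⟨⟨x, y⟩, ⟨h0, h1, h2⟩, rfl⟩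
    exact h x y h0 h1 h2

theorem abs_eval_slope_le (a b c : ℝ) {m : ℝ} (h0 : 0 ≤ m) (h1 : m ≤ 1) :
    |a + b * m ^ 2 + c * m| ≤ (1 + m ^ 2) * secNorm a b c := by
  have hpos : 0 < 1 + m ^ 2 := by positivity
  set r := (√(1 + m ^ 2))⁻¹ with hr
  have hr0 : 0 ≤ r := by positivity
  have hr2 : r ^ 2 = (1 + m ^ 2)⁻¹ := by rw [hr, inv_pow, Real.sq_sqrt hpos.le]
  have hmem : (r, r * m) ∈ sector := by
    refine ⟨mul_nonneg hr0 h0, mul_le_of_le_one_right hr0 h1, le_of_eq ?_⟩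
    calc r ^ 2 + (r * m) ^ 2 = r ^ 2 * (1 + m ^ 2) := by ring
      _ = 1 := by rw [hr2, inv_mul_cancel₀ hpos.ne']
  have h := abs_le_secNorm a b c hmem
  have e : a * r ^ 2 + b * (r * m) ^ 2 + c * r * (r * m)
      = (1 + m ^ 2)⁻¹ * (a + b * m ^ 2 + c * m) := by rw [← hr2]; ring
  dsimp only at h
  rwa [e, abs_mul, abs_of_pos (inv_pos.2 hpos), inv_mul_le_iff₀ hpos] at h

/-- Coefficient bounds, from the values at the slopes `0`, `√2 - 1` and `1`. -/
theorem abs_coeff_le (a b c : ℝ) :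
    |a| ≤ secNorm a b c ∧ |b| ≤ (5 + 4 * √2) * secNorm a b c ∧
      |c| ≤ (4 + 4 * √2) * secNorm a b c := by
  have hs : √2 ^ 2 = 2 := Real.sq_sqrt (by norm_num)
  have hs1 : 1 ≤ √2 := by rw [Real.one_le_sqrt]; norm_num
  have hs2 : √2 ≤ 2 := by nlinarith
  have A := abs_eval_slope_le a b c le_rfl zero_le_one
  have B := abs_eval_slope_le a b c zero_le_one le_rfl
  have C := abs_eval_slope_le a b c (m := √2 - 1) (by linarith) (by linarith)
  have hm : (√2 - 1) ^ 2 = 3 - 2 * √2 := by linear_combination hs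
  rw [hm] at C
  set M := secNorm a b c
  norm_num at A B
  rw [abs_le] at B C
  have hA := abs_le.1 A
  have hb : b = (2 + 3 / 2 * √2) * ((2 - √2) * a + (√2 - 1) * (a + b + c)
      - (a + b * (3 - 2 * √2) + c * (√2 - 1))) := by
    linear_combination (-9 / 2 * b) * hs
  have hc : c = (2 + 3 / 2 * √2) * ((a + b * (3 - 2 * √2) + c * (√2 - 1))
      - (2 * √2 - 2) * a - (3 - 2 * √2) * (a + b + c)) := by
    linear_combination (-9 / 2 * c) * hs
  have hk : 0 ≤ 2 + 3 / 2 * √2 := by positivity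
  have eb : (5 + 4 * √2) * M = (2 + 3 / 2 * √2) * ((2 - √2) * M + (√2 - 1) * (2 * M)
      + (1 + (3 - 2 * √2)) * M) := by
    linear_combination (3 / 2 * M) * hs
  have ec : (4 + 4 * √2) * M = (2 + 3 / 2 * √2) * ((2 * √2 - 2) * M + (3 - 2 * √2) * (2 * M)
      + (1 + (3 - 2 * √2)) * M) := by
    linear_combination (6 * M) * hs
  have h3 : 0 ≤ 3 - 2 * √2 := by nlinarith
  refine ⟨A, abs_le.2 ⟨?_, ?_⟩, abs_le.2 ⟨?_, ?_⟩⟩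
  · rw [eb, hb, ← mul_neg]
    refine mul_le_mul_of_nonneg_left ?_ hk
    nlinarith
  · rw [eb, hb]
    refine mul_le_mul_of_nonneg_left ?_ hk
    nlinarith
  · rw [ec, hc, ← mul_neg]
    refine mul_le_mul_of_nonneg_left ?_ hk
    nlinarith
  · rw [ec, hc]
    refine mul_le_mul_of_nonneg_left ?_ hk
    nlinarith

theorem secNorm_le_of_abs_le {a b c M : ℝ} (ha : |a| ≤ M) (hb : |b| ≤ (5 + 4 * √2) * M)
    (hc : |c| ≤ (4 + 4 * √2) * M) : secNorm |a| |b| |c| ≤ (5 + 4 * √2) * M := by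
  have hM : 0 ≤ M := (abs_nonneg a).trans ha
  refine secNorm_le fun x y h0 h1 h2 => ?_
  have hx : 0 ≤ x := h0.trans h1
  rw [abs_of_nonneg (by positivity)]
  calc |a| * x ^ 2 + |b| * y ^ 2 + |c| * x * y
      ≤ M * x ^ 2 + (5 + 4 * √2) * M * y ^ 2 + (4 + 4 * √2) * M * x * x := by gcongr
    _ = (5 + 4 * √2) * M * (x ^ 2 + y ^ 2) := by ring
    _ ≤ (5 + 4 * √2) * M := mul_le_of_le_one_right (by positivity) h2

theorem secNorm_extremal : secNorm 1 (5 + 4 * √2) (-4 - 4 * √2) = 1 := by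
  have hs : √2 ^ 2 = 2 := Real.sq_sqrt (by norm_num)
  apply le_antisymm
  · refine secNorm_le fun x y h0 h1 h2 => abs_le.2 ⟨?_, ?_⟩
    · have e : 1 * x ^ 2 + (5 + 4 * √2) * y ^ 2 + (-4 - 4 * √2) * x * y
          = 2 * (x - (1 + √2) * y) ^ 2 - (x ^ 2 + y ^ 2) := by
        linear_combination (-2 * y ^ 2) * hs
      rw [e]
      linarith [sq_nonneg (x - (1 + √2) * y)]
    · have h : 0 ≤ (4 + 4 * √2) * (y * (x - y)) :=
        mul_nonneg (by positivity) (mul_nonneg h0 (sub_nonneg.2 h1))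
      linarith
  · simpa using (abs_coeff_le 1 (5 + 4 * √2) (-4 - 4 * √2)).1

theorem secNorm_extremal_modulus :
    secNorm 1 (5 + 4 * √2) (4 + 4 * √2) = 5 + 4 * √2 := by
  have hb : (0 : ℝ) ≤ 5 + 4 * √2 := by positivity
  have hc : (0 : ℝ) ≤ 4 + 4 * √2 := by positivity
  apply le_antisymm
  · have h := secNorm_le_of_abs_le (a := 1) (b := 5 + 4 * √2) (c := 4 + 4 * √2) (M := 1)
      (by simp) (by rw [abs_of_nonneg hb, mul_one]) (by rw [abs_of_nonneg hc, mul_one])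
    rwa [abs_of_nonneg hb, abs_of_nonneg hc, abs_one, mul_one] at h
  · have h := (le_abs_self _).trans
      (abs_eval_slope_le 1 (5 + 4 * √2) (4 + 4 * √2) zero_le_one le_rfl)
    linarith

theorem stmt_10 :
    (∀ a b c : ℝ, secNorm |a| |b| |c| ≤ (5 + 4 * Real.sqrt 2) * secNorm a b c) ∧
    secNorm 1 (5 + 4 * Real.sqrt 2) (-4 - 4 * Real.sqrt 2) = 1 ∧
    secNorm 1 (5 + 4 * Real.sqrt 2) (4 + 4 * Real.sqrt 2) = 5 + 4 * Real.sqrt 2 ∧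
    IsLeast {K : ℝ | ∀ a b c : ℝ, secNorm |a| |b| |c| ≤ K * secNorm a b c}
      (5 + 4 * Real.sqrt 2) := by
  have main : ∀ a b c : ℝ, secNorm |a| |b| |c| ≤ (5 + 4 * √2) * secNorm a b c := fun a b c =>
    have ⟨ha, hb, hc⟩ := abs_coeff_le a b c
    secNorm_le_of_abs_le ha hb hc
  refine ⟨main, secNorm_extremal, secNorm_extremal_modulus, main, fun K hK => ?_⟩
  have h := hK 1 (5 + 4 * √2) (-4 - 4 * √2)
  have hb : (0 : ℝ) ≤ 5 + 4 * √2 := by positivity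
  have hc : -4 - 4 * √2 = -(4 + 4 * √2) := by ring
  have hc' : (0 : ℝ) ≤ 4 + 4 * √2 := by positivity
  rwa [secNorm_extremal, abs_one, abs_of_nonneg hb, hc, abs_neg, abs_of_nonneg hc',
    secNorm_extremal_modulus, mul_one] at h
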